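/- arXiv:1201.6303 — 9 statements merged into one kernel-verified Lean document; each statement's English description precedes it below -/
import Mathlib

section
/- Assume (A3): there exist c₁ > 0 and ε₀ ∈ (0,1) such that F₁⁽ⁿ⁾(s) ≥ c₁ for all s ∈ (−1,−1+ε₀] ∪ [1−ε₀,1); and (A4): there exists ε₀ ∈ (0,1) such that F₁⁽ᵏ⁾(s) ≥ 0 for all s ∈ [1−ε₀,1) and all k = 0,1,…,n, and F₁⁽²ʲ⁺²⁾(s) ≥ 0 and F₁⁽²ʲ⁺¹⁾(s) ≤ 0 for all s ∈ (−1,−1+ε₀] and all j = 0,1,…,q. Let F̄₂ : ℝ → ℝ be a function bounded from below, i.e. there is m ∈ ℝ with F̄₂(s) ≥ m for all s ∈ ℝ. Then there exist constants c_q > 0, d_q > 0 and ε₀' ∈ (0,1), all independent of ε, such that for every ε ∈ (0,ε₀'] and every s ∈ ℝ one has F₁ε(s) + F̄₂(s) ≥ c_q·|s|ⁿ − d_q. -/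
/-- The approximate potential `F₁ε`: equal to `F₁` on `[-(1-ε), 1-ε]` and extended
outside by the `n`-th order Taylor polynomial of `F₁` at `±(1-ε)`. -/
noncomputable def approxPot (n : ℕ) (F₁ : ℝ → ℝ) (ε : ℝ) (s : ℝ) : ℝ :=
  if 1 - ε ≤ s then
    ∑ k ∈ Finset.range (n + 1),
      (1 / (Nat.factorial k : ℝ)) * iteratedDeriv k F₁ (1 - ε) * (s - (1 - ε)) ^ k
  else if s ≤ -(1 - ε) then
    ∑ k ∈ Finset.range (n + 1),
      (1 / (Nat.factorial k : ℝ)) * iteratedDeriv k F₁ (-1 + ε) * (s - (-1 + ε)) ^ k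
  else F₁ s

/-- A function on `(-1, 1)` that is differentiable, nonincreasing near `-1` and nonnegative near `1`
is bounded below. -/
lemma exists_lowerBound_Ioo {F : ℝ → ℝ} {δ : ℝ} (hδ : δ ∈ Set.Ioo (0 : ℝ) 1)
    (hdF : DifferentiableOn ℝ F (Set.Ioo (-1 : ℝ) 1))
    (hl : ∀ s ∈ Set.Ioc (-1 : ℝ) (-1 + δ), deriv F s ≤ 0)
    (hr : ∀ s ∈ Set.Ico (1 - δ) (1 : ℝ), 0 ≤ F s) :
    ∃ B : ℝ, 0 ≤ B ∧ ∀ s ∈ Set.Ioo (-1 : ℝ) 1, -B ≤ F s := by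
  obtain ⟨h0, h1⟩ := hδ
  have hF := hdF.continuousOn
  have hanti : AntitoneOn F (Set.Ioc (-1 : ℝ) (-1 + δ)) := by
    refine antitoneOn_of_deriv_nonpos (convex_Ioc _ _)
      (hF.mono fun x hx => ⟨hx.1, by linarith [hx.2]⟩) ?_ fun x hx => ?_
    · rw [interior_Ioc]
      exact hdF.mono fun x hx => ⟨hx.1, by linarith [hx.2]⟩
    · rw [interior_Ioc] at hx
      exact hl x ⟨hx.1, hx.2.le⟩
  obtain ⟨x, -, hx⟩ := (isCompact_Icc (a := -1 + δ) (b := 1 - δ)).exists_isMinOn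
    ⟨-1 + δ, le_rfl, by linarith⟩ (hF.mono fun y hy => ⟨by linarith [hy.1], by linarith [hy.2]⟩)
  have hmin : ∀ y ∈ Set.Icc (-1 + δ) (1 - δ), F x ≤ F y := fun y hy => hx hy
  refine ⟨|F x|, abs_nonneg _, fun s hs => ?_⟩
  have hFx := neg_abs_le (F x)
  rcases le_total s (-1 + δ) with hsl | hsl
  · have := hanti ⟨hs.1, hsl⟩ ⟨by linarith, le_rfl⟩ hsl
    linarith [hmin (-1 + δ) ⟨le_rfl, by linarith⟩]
  rcases le_total s (1 - δ) with hsr | hsr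
  · linarith [hmin s ⟨hsl, hsr⟩]
  · linarith [hr s ⟨hsr, hs.2⟩, abs_nonneg (F x)]

/-- The sum of a sequence over `0, …, n` is at least its first plus its last term when all terms
other than the first are nonnegative. -/
lemma add_le_sum_range_succ {n : ℕ} (hn : 0 < n) {f : ℕ → ℝ}
    (hf : ∀ k, 0 < k → k ≤ n → 0 ≤ f k) :
    f 0 + f n ≤ ∑ k ∈ Finset.range (n + 1), f k := by
  obtain ⟨p, rfl⟩ : ∃ p, n = p + 1 := ⟨n - 1, by omega⟩
  rw [Finset.sum_range_succ, Finset.sum_range_succ']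
  have : 0 ≤ ∑ k ∈ Finset.range p, f (k + 1) :=
    Finset.sum_nonneg fun k hk => hf _ (by omega) (by have := Finset.mem_range.1 hk; omega)
  linarith

/-- A Taylor-type polynomial of even degree centred at a point of `[-1, 1]`, with nonnegative
terms of positive order, grows at least like `|s| ^ n`. -/
lemma coercive_taylor_sum {n : ℕ} (hn : 0 < n) (hne : Even n) {a : ℕ → ℝ} {x c B s : ℝ}
    (hc : 0 ≤ c) (hx : |x| ≤ 1) (h0 : -B ≤ a 0) (hnc : c ≤ a n)
    (hnonneg : ∀ k, 0 < k → k ≤ n → 0 ≤ a k * (s - x) ^ k) :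
    c / n.factorial / 2 ^ (n - 1) * |s| ^ n - (c / n.factorial + B) ≤
      ∑ k ∈ Finset.range (n + 1), (1 / (k.factorial : ℝ)) * a k * (s - x) ^ k := by
  have hsum := add_le_sum_range_succ hn
    (f := fun k => (1 / (k.factorial : ℝ)) * a k * (s - x) ^ k) fun k hk hkn => by
      have := hnonneg k hk hkn
      rw [mul_assoc]
      positivity
  refine le_trans ?_ hsum
  have hs : |s| ^ n ≤ 2 ^ (n - 1) * (|s - x| ^ n + 1) := by
    have h1 : |s| ≤ |s - x| + 1 := by
      have := abs_add_le (s - x) x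
      rw [sub_add_cancel] at this
      linarith
    calc |s| ^ n ≤ (|s - x| + 1) ^ n := by gcongr
      _ ≤ 2 ^ (n - 1) * (|s - x| ^ n + 1 ^ n) :=
        add_pow_le (abs_nonneg _) zero_le_one n
      _ = _ := by rw [one_pow]
  rw [hne.pow_abs (s - x)] at hs
  have hpow : 0 ≤ (s - x) ^ n := hne.pow_nonneg _
  have h1 : c / n.factorial / 2 ^ (n - 1) * |s| ^ n ≤ c / n.factorial * ((s - x) ^ n + 1) := by
    rw [div_mul_eq_mul_div, div_le_iff₀ (by positivity)]
    calc c / n.factorial * |s| ^ n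
        ≤ c / n.factorial * (2 ^ (n - 1) * ((s - x) ^ n + 1)) := by gcongr
      _ = _ := by ring
  have h2 : c / n.factorial * (s - x) ^ n ≤ 1 / (n.factorial : ℝ) * a n * (s - x) ^ n := by
    rw [one_div_mul_eq_div]
    gcongr
  simp only [Nat.factorial_zero, Nat.cast_one, div_one, one_mul, pow_zero, mul_one]
  linarith

theorem stmt0
    (q : ℕ) (hq : 0 < q) (n : ℕ) (hn : n = 2 + 2 * q)
    (F₁ : ℝ → ℝ) (hF₁ : ContDiffOn ℝ n F₁ (Set.Ioo (-1 : ℝ) 1))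
    -- (A3)
    (c₁ : ℝ) (hc₁ : 0 < c₁) (ε₀ : ℝ) (hε₀ : ε₀ ∈ Set.Ioo (0 : ℝ) 1)
    (hA3 : ∀ s : ℝ, s ∈ Set.Ioc (-1 : ℝ) (-1 + ε₀) ∪ Set.Ico (1 - ε₀) 1 →
      c₁ ≤ iteratedDeriv n F₁ s)
    -- (A4)
    (ε₀' : ℝ) (hε₀' : ε₀' ∈ Set.Ioo (0 : ℝ) 1)
    (hA4₁ : ∀ k ≤ n, ∀ s ∈ Set.Ico (1 - ε₀') (1 : ℝ), 0 ≤ iteratedDeriv k F₁ s)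
    (hA4₂ : ∀ j ≤ q, ∀ s ∈ Set.Ioc (-1 : ℝ) (-1 + ε₀'),
      0 ≤ iteratedDeriv (2 * j + 2) F₁ s)
    (hA4₃ : ∀ j ≤ q, ∀ s ∈ Set.Ioc (-1 : ℝ) (-1 + ε₀'),
      iteratedDeriv (2 * j + 1) F₁ s ≤ 0)
    -- F̄₂ bounded from below
    (F₂ : ℝ → ℝ) (m : ℝ) (hF₂ : ∀ s, m ≤ F₂ s) :
    ∃ cq dq εs : ℝ, 0 < cq ∧ 0 < dq ∧ εs ∈ Set.Ioo (0 : ℝ) 1 ∧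
      ∀ ε ∈ Set.Ioc (0 : ℝ) εs, ∀ s : ℝ,
        cq * |s| ^ n - dq ≤ approxPot n F₁ ε s + F₂ s := by
  set δ := min ε₀ ε₀'
  have hδ₀ : δ ≤ ε₀ := min_le_left _ _
  have hδ₀' : δ ≤ ε₀' := min_le_right _ _
  have hδm : δ ∈ Set.Ioo (0 : ℝ) 1 := ⟨lt_min hε₀.1 hε₀'.1, hδ₀.trans_lt hε₀.2⟩
  obtain ⟨B, hB, hFB⟩ := exists_lowerBound_Ioo hδm
    (hF₁.differentiableOn (by simp; omega))
    (fun s hs => by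
      simpa [iteratedDeriv_one] using hA4₃ 0 (Nat.zero_le _) s ⟨hs.1, by linarith [hs.2]⟩)
    (fun s hs => by
      simpa [iteratedDeriv_zero] using hA4₁ 0 (Nat.zero_le _) s ⟨by linarith [hs.1], hs.2⟩)
  have hn0 : 0 < n := by omega
  have hne : Even n := ⟨1 + q, by omega⟩
  have hc : 0 < c₁ / n.factorial := by positivity
  refine ⟨c₁ / n.factorial / 2 ^ (n - 1), c₁ / n.factorial + B + |m|, δ, by positivity,
    by positivity, hδm, fun ε hε s => ?_⟩
  suffices h : c₁ / n.factorial / 2 ^ (n - 1) * |s| ^ n - (c₁ / n.factorial + B) ≤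
      approxPot n F₁ ε s by
    linarith [hF₂ s, neg_abs_le m]
  have hε0 := hε.1
  have hεδ := hε.2
  have hδ1 := hδm.2
  unfold approxPot
  split_ifs with hr hl
  · refine coercive_taylor_sum (a := fun k => iteratedDeriv k F₁ (1 - ε)) hn0 hne hc₁.le
      (abs_le.2 ⟨by linarith, by linarith⟩) ?_ ?_ fun k _ hkn => ?_
    · simpa [iteratedDeriv_zero] using hFB (1 - ε) ⟨by linarith, by linarith⟩
    · exact hA3 _ (.inr ⟨by linarith, by linarith⟩)
    · exact mul_nonneg (hA4₁ k hkn _ ⟨by linarith, by linarith⟩)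
        (pow_nonneg (by linarith) k)
  · have hmem : -1 + ε ∈ Set.Ioc (-1 : ℝ) (-1 + ε₀') := ⟨by linarith, by linarith⟩
    refine coercive_taylor_sum (a := fun k => iteratedDeriv k F₁ (-1 + ε)) hn0 hne hc₁.le
      (abs_le.2 ⟨by linarith, by linarith⟩) ?_ ?_ fun k hk hkn => ?_
    · simpa [iteratedDeriv_zero] using hFB (-1 + ε) ⟨by linarith, by linarith⟩
    · exact hA3 _ (.inl ⟨by linarith, by linarith⟩)
    · rcases Nat.even_or_odd' k with ⟨j, rfl | rfl⟩
      · obtain ⟨i, rfl⟩ : ∃ i, j = i + 1 := ⟨j - 1, by omega⟩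
        exact mul_nonneg (hA4₂ i (by omega) _ hmem) ((even_two_mul _).pow_nonneg _)
      · exact mul_nonneg_of_nonpos_of_nonpos (hA4₃ j (by omega) _ hmem)
          ((odd_two_mul_add_one j).pow_nonpos (by linarith))
  · push Not at hr hl
    have hs : |s| ≤ 1 := abs_le.2 ⟨by linarith, by linarith⟩
    have h1 : c₁ / n.factorial / 2 ^ (n - 1) * |s| ^ n ≤ c₁ / n.factorial :=
      (mul_le_of_le_one_right (by positivity) (pow_le_one₀ (abs_nonneg s) hs)).trans
        (div_le_self hc.le (one_le_pow₀ one_le_two))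
    linarith [hFB s ⟨by linarith, by linarith⟩]
end

section
/- Assume (A4): there exists ε₀ ∈ (0,1) such that F₁⁽ᵏ⁾(s) ≥ 0 for all s ∈ [1−ε₀,1) and all k = 0,1,…,n, and F₁⁽²ʲ⁺²⁾(s) ≥ 0 and F₁⁽²ʲ⁺¹⁾(s) ≤ 0 for all s ∈ (−1,−1+ε₀] and all j = 0,1,…,q. Assume moreover that there is α ∈ ℝ with F₁''(s) ≥ α for all s ∈ (−1,1). Then there exists ε₁ ∈ (0,1) such that for every ε ∈ (0,ε₁] the second derivative of the approximate potential satisfies F₁ε''(s) ≥ α for all s ∈ ℝ. -/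
/-- The function equal to `P` on `(-∞, a]`, to `F` on `(a, b)` and to `Q` on `[b, ∞)`. -/
noncomputable def glue (a b : ℝ) (P F Q : ℝ → ℝ) (s : ℝ) : ℝ :=
  if b ≤ s then Q s else if s ≤ a then P s else F s

open Topology in
theorem hasDerivAt_of_Iic_of_Ici {f g h : ℝ → ℝ} {x d : ℝ} (hg : HasDerivAt g d x)
    (hh : HasDerivAt h d x) (hfg : ∀ᶠ y in 𝓝 x, y ≤ x → f y = g y)
    (hfh : ∀ᶠ y in 𝓝 x, x ≤ y → f y = h y) : HasDerivAt f d x := by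
  have hl : HasDerivWithinAt f d (Set.Iic x) x :=
    hg.hasDerivWithinAt.congr_of_eventuallyEq (eventually_nhdsWithin_iff.2 hfg)
      (hfg.self_of_nhds le_rfl)
  have hr : HasDerivWithinAt f d (Set.Ici x) x :=
    hh.hasDerivWithinAt.congr_of_eventuallyEq (eventually_nhdsWithin_iff.2 hfh)
      (hfh.self_of_nhds le_rfl)
  have hu := hl.union hr
  rwa [Set.Iic_union_Ici, hasDerivWithinAt_univ] at hu

theorem hasDerivAt_glue {a b : ℝ} (hab : a < b) {P F Q P' F' Q' : ℝ → ℝ}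
    (hP : ∀ s, HasDerivAt P (P' s) s) (hQ : ∀ s, HasDerivAt Q (Q' s) s)
    (hF : ∀ s ∈ Set.Icc a b, HasDerivAt F (F' s) s)
    (ha : P a = F a) (hb : Q b = F b) (ha' : P' a = F' a) (hb' : Q' b = F' b) (s : ℝ) :
    HasDerivAt (glue a b P F Q) (glue a b P' F' Q' s) s := by
  rcases lt_trichotomy s a with h | rfl | h
  · have e : glue a b P' F' Q' s = P' s := by
      simp [glue, h.le, (h.trans hab).not_ge]
    rw [e]
    refine (hP s).congr_of_eventuallyEq ?_
    filter_upwards [Iio_mem_nhds h] with y (hy : y < a)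
    simp [glue, hy.le, (hy.trans hab).not_ge]
  · have e : glue s b P' F' Q' s = P' s := by simp [glue, hab.not_ge]
    rw [e]
    refine hasDerivAt_of_Iic_of_Ici (hP s) (ha' ▸ hF s ⟨le_rfl, hab.le⟩) ?_ ?_
    · filter_upwards with y hy
      simp [glue, hy, (hy.trans_lt hab).not_ge]
    · filter_upwards [Iio_mem_nhds hab] with y (hy : y < b) hsy
      rcases hsy.eq_or_lt with rfl | hlt
      · simp [glue, hab.not_ge, ha]
      · simp [glue, hy.not_ge, hlt.not_ge]
  · rcases lt_trichotomy s b with h2 | rfl | h2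
    · have e : glue a b P' F' Q' s = F' s := by simp [glue, h.not_ge, h2.not_ge]
      rw [e]
      refine (hF s ⟨h.le, h2.le⟩).congr_of_eventuallyEq ?_
      filter_upwards [Ioo_mem_nhds h h2] with y hy
      simp [glue, hy.1.not_ge, hy.2.not_ge]
    · have e : glue a s P' F' Q' s = Q' s := by simp [glue]
      rw [e]
      refine hasDerivAt_of_Iic_of_Ici (hb' ▸ hF s ⟨hab.le, le_rfl⟩) (hQ s) ?_ ?_
      · filter_upwards [Ioi_mem_nhds hab] with y (hy : a < y) hys
        rcases hys.eq_or_lt with rfl | hlt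
        · simp [glue, hb]
        · simp [glue, hy.not_ge, hlt.not_ge]
      · filter_upwards with y hy
        simp [glue, hy]
    · have e : glue a b P' F' Q' s = Q' s := by simp [glue, h2.le]
      rw [e]
      refine (hQ s).congr_of_eventuallyEq ?_
      filter_upwards [Ioi_mem_nhds h2] with y (hy : b < y)
      simp [glue, hy.le]

/-- The polynomial function `∑_{k < m} c k / k! * (s - a) ^ k`. -/
noncomputable def taylorSum (m : ℕ) (c : ℕ → ℝ) (a s : ℝ) : ℝ :=
  ∑ k ∈ Finset.range m, (1 / (Nat.factorial k : ℝ)) * c k * (s - a) ^ k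

theorem taylorSum_self (m : ℕ) (c : ℕ → ℝ) (a : ℝ) : taylorSum (m + 1) c a a = c 0 := by
  simp [taylorSum, Finset.sum_range_succ']

theorem hasDerivAt_taylorSum (m : ℕ) (c : ℕ → ℝ) (a s : ℝ) :
    HasDerivAt (taylorSum (m + 1) c a) (taylorSum m (fun k => c (k + 1)) a s) s := by
  have h : HasDerivAt (fun s => ∑ k ∈ Finset.range (m + 1),
      (1 / (Nat.factorial k : ℝ)) * c k * (s - a) ^ k)
      (∑ k ∈ Finset.range (m + 1), (1 / (Nat.factorial k : ℝ)) * c k *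
        (k * (s - a) ^ (k - 1) * 1)) s :=
    HasDerivAt.fun_sum fun k _ => (((hasDerivAt_id s).sub_const a).pow k).const_mul _
  refine h.congr_deriv ?_
  rw [Finset.sum_range_succ']
  simp only [taylorSum, Nat.factorial_succ]
  simp only [Nat.cast_zero, zero_mul, mul_zero, add_zero]
  refine Finset.sum_congr rfl fun k _ => ?_
  have hk : (Nat.factorial k : ℝ) ≠ 0 := by positivity
  push_cast
  field_simp

theorem le_taylorSum (m : ℕ) (c : ℕ → ℝ) (a s : ℝ)
    (h : ∀ k < m, 0 ≤ c (k + 1) * (s - a) ^ (k + 1)) : c 0 ≤ taylorSum (m + 1) c a s := by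
  rw [taylorSum, Finset.sum_range_succ']
  have : 0 ≤ ∑ k ∈ Finset.range m,
      (1 / (Nat.factorial (k + 1) : ℝ)) * c (k + 1) * (s - a) ^ (k + 1) := by
    refine Finset.sum_nonneg fun k hk => ?_
    rw [mul_assoc]
    exact mul_nonneg (by positivity) (h k (Finset.mem_range.1 hk))
  simpa using this

theorem stmt2
    (q : ℕ) (hq : 0 < q) (n : ℕ) (hn : n = 2 + 2 * q)
    (F₁ : ℝ → ℝ) (hF₁ : ContDiffOn ℝ n F₁ (Set.Ioo (-1 : ℝ) 1))
    -- (A4)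
    (ε₀ : ℝ) (hε₀ : ε₀ ∈ Set.Ioo (0 : ℝ) 1)
    (hA4₁ : ∀ k ≤ n, ∀ s ∈ Set.Ico (1 - ε₀) (1 : ℝ), 0 ≤ iteratedDeriv k F₁ s)
    (hA4₂ : ∀ j ≤ q, ∀ s ∈ Set.Ioc (-1 : ℝ) (-1 + ε₀),
      0 ≤ iteratedDeriv (2 * j + 2) F₁ s)
    (hA4₃ : ∀ j ≤ q, ∀ s ∈ Set.Ioc (-1 : ℝ) (-1 + ε₀),
      iteratedDeriv (2 * j + 1) F₁ s ≤ 0)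
    -- F₁'' ≥ α on (-1,1)
    (α : ℝ) (hα : ∀ s ∈ Set.Ioo (-1 : ℝ) 1, α ≤ iteratedDeriv 2 F₁ s) :
    ∃ ε₁ : ℝ, ε₁ ∈ Set.Ioo (0 : ℝ) 1 ∧
      ∀ ε ∈ Set.Ioc (0 : ℝ) ε₁, ∀ s : ℝ,
        α ≤ iteratedDeriv 2 (approxPot n F₁ ε) s := by
  subst hn
  refine ⟨ε₀, hε₀, fun ε hε s => ?_⟩
  obtain ⟨hε0, hεle⟩ := hε
  have hε1 : ε < 1 := hεle.trans_lt hε₀.2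
  have hab : -1 + ε < 1 - ε := by linarith
  have hsub : Set.Icc (-1 + ε) (1 - ε) ⊆ Set.Ioo (-1 : ℝ) 1 := fun x hx =>
    ⟨by linarith [hx.1], by linarith [hx.2]⟩
  have hC2 : ContDiffOn ℝ 2 F₁ (Set.Ioo (-1 : ℝ) 1) :=
    hF₁.of_le (by exact_mod_cast Nat.le_add_right 2 (2 * q))
  have hd (s) (hs : s ∈ Set.Icc (-1 + ε) (1 - ε)) : HasDerivAt F₁ (iteratedDeriv 1 F₁ s) s := by
    rw [iteratedDeriv_one]
    exact ((hC2.differentiableOn (by norm_num)).differentiableAt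
      (isOpen_Ioo.mem_nhds (hsub hs))).hasDerivAt
  have hd' (s) (hs : s ∈ Set.Icc (-1 + ε) (1 - ε)) :
      HasDerivAt (iteratedDeriv 1 F₁) (iteratedDeriv 2 F₁ s) s := by
    rw [iteratedDeriv_succ (n := 1), iteratedDeriv_one]
    have h1 : ContDiffOn ℝ 1 (deriv F₁) (Set.Ioo (-1 : ℝ) 1) :=
      hC2.deriv_of_isOpen isOpen_Ioo (by norm_num)
    exact ((h1.differentiableOn (by norm_num)).differentiableAt
      (isOpen_Ioo.mem_nhds (hsub hs))).hasDerivAt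
  let T (i : ℕ) (a : ℝ) : ℝ → ℝ :=
    taylorSum (2 * q + 1 + (2 - i)) (fun k => iteratedDeriv (k + i) F₁ a) a
  let G (i : ℕ) : ℝ → ℝ :=
    glue (-1 + ε) (1 - ε) (T i (-1 + ε)) (iteratedDeriv i F₁) (T i (1 - ε))
  have hT0 (a s) : HasDerivAt (T 0 a) (T 1 a s) s :=
    hasDerivAt_taylorSum (2 * q + 2) (fun k => iteratedDeriv k F₁ a) a s
  have hT1 (a s) : HasDerivAt (T 1 a) (T 2 a s) s :=
    hasDerivAt_taylorSum (2 * q + 1) (fun k => iteratedDeriv (k + 1) F₁ a) a s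
  have hTa0 (a) : T 0 a a = iteratedDeriv 0 F₁ a :=
    taylorSum_self (2 * q + 2) (fun k => iteratedDeriv k F₁ a) a
  have hTa1 (a) : T 1 a a = iteratedDeriv 1 F₁ a := by
    simpa using taylorSum_self (2 * q + 1) (fun k => iteratedDeriv (k + 1) F₁ a) a
  have hTa2 (a) : T 2 a a = iteratedDeriv 2 F₁ a := by
    simpa using taylorSum_self (2 * q) (fun k => iteratedDeriv (k + 2) F₁ a) a
  have hG : approxPot (2 + 2 * q) F₁ ε = G 0 := by
    ext x
    have e1 : -(1 - ε) = -1 + ε := by ring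
    have e2 : 2 + 2 * q + 1 = 2 * q + 1 + 2 := by ring
    simp only [approxPot, G, T, glue, taylorSum, e1, e2, iteratedDeriv_zero, add_zero, Nat.sub_zero]
  have hG0 (s) : HasDerivAt (G 0) (G 1 s) s :=
    hasDerivAt_glue hab (hT0 _) (hT0 _) (by simpa using hd) (hTa0 _) (hTa0 _) (hTa1 _) (hTa1 _) s
  have hG1 (s) : HasDerivAt (G 1) (G 2 s) s :=
    hasDerivAt_glue hab (hT1 _) (hT1 _) hd' (hTa1 _) (hTa1 _) (hTa2 _) (hTa2 _) s
  rw [hG, iteratedDeriv_succ (n := 1), iteratedDeriv_one, funext fun s => (hG0 s).deriv,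
    (hG1 s).deriv]
  change α ≤ glue _ _ _ _ _ s
  unfold glue
  split_ifs with h1 h2
  · refine (hα _ (hsub ⟨hab.le, le_rfl⟩)).trans ?_
    refine le_trans (by simp) (le_taylorSum (2 * q) (fun k => iteratedDeriv (k + 2) F₁ (1 - ε))
      (1 - ε) s fun k hk => ?_)
    exact mul_nonneg (hA4₁ _ (by omega) _ ⟨by linarith, by linarith⟩)
      (pow_nonneg (by linarith) _)
  · refine (hα _ (hsub ⟨le_rfl, hab.le⟩)).trans ?_
    refine le_trans (by simp) (le_taylorSum (2 * q) (fun k => iteratedDeriv (k + 2) F₁ (-1 + ε))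
      (-1 + ε) s fun k hk => ?_)
    have hmem : -1 + ε ∈ Set.Ioc (-1 : ℝ) (-1 + ε₀) := ⟨by linarith, by linarith⟩
    have hs : s - (-1 + ε) ≤ 0 := by linarith
    rcases Nat.even_or_odd' (k + 1) with ⟨j, hj | hj⟩
    · simp only [hj]
      exact mul_nonneg (hA4₂ j (by omega) _ hmem) ((even_two_mul j).pow_nonneg _)
    · simp only [hj]
      exact mul_nonneg_of_nonpos_of_nonpos (hA4₃ (j + 1) (by omega) _ hmem)
        (Odd.pow_nonpos (odd_two_mul_add_one j) hs)
  · exact hα s (hsub ⟨(not_le.1 h2).le, (not_le.1 h1).le⟩)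
end

section
/- Assume (A4): there exists ε₀ ∈ (0,1) such that F₁⁽ᵏ⁾(s) ≥ 0 for all s ∈ [1−ε₀,1) and all k = 0,1,…,n, and F₁⁽²ʲ⁺²⁾(s) ≥ 0 and F₁⁽²ʲ⁺¹⁾(s) ≤ 0 for all s ∈ (−1,−1+ε₀] and all j = 0,1,…,q. Assume there are α, β, γ ∈ ℝ with α + β + γ > 0 such that F₁''(s) ≥ α for all s ∈ (−1,1). Let F̄₂ : ℝ → ℝ be twice differentiable with F̄₂''(s) ≥ γ for all s ∈ ℝ, let (Ω,μ) be a measure space and let a : Ω → ℝ be a measurable function with a(x) ≥ β for μ-a.e. x ∈ Ω. Set c₀ := α + β + γ. Then there exists ε₁ ∈ (0,1) such that for every ε ∈ (0,ε₁], every s ∈ ℝ and μ-a.e. x ∈ Ω one has F₁ε''(s) + F̄₂''(s) + a(x) ≥ c₀. -/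
/-- Differentiability of a function glued at `c` from two pieces agreeing to first order. -/
theorem HasDerivAt.ite_le {f g f' g' : ℝ → ℝ} {c s : ℝ}
    (hf : c ≤ s → HasDerivAt f (f' s) s) (hg : s ≤ c → HasDerivAt g (g' s) s)
    (h : f c = g c) (h' : f' c = g' c) :
    HasDerivAt (fun t => if c ≤ t then f t else g t) (if c ≤ s then f' s else g' s) s := by
  rcases lt_trichotomy s c with hs | rfl | hs
  · rw [if_neg hs.not_ge]
    refine (hg hs.le).congr_of_eventuallyEq ?_
    filter_upwards [eventually_lt_nhds hs] with t ht
    exact if_neg ht.not_ge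
  · rw [if_pos le_rfl, ← hasDerivWithinAt_univ, ← Set.Iic_union_Ici (a := s)]
    refine HasDerivWithinAt.union ?_ ?_
    · rw [h']
      refine (hg le_rfl).hasDerivWithinAt.congr (fun t ht => ?_) (by simp [h])
      rcases (Set.mem_Iic.1 ht).eq_or_lt with rfl | ht
      · simp [h]
      · exact if_neg ht.not_ge
    · exact (hf le_rfl).hasDerivWithinAt.congr (fun t ht => if_pos ht) (if_pos le_rfl)
  · rw [if_pos hs.le]
    refine (hf hs.le).congr_of_eventuallyEq ?_
    filter_upwards [eventually_gt_nhds hs] with t ht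
    exact if_pos ht.le

/-- Differentiability of a function glued at `c` from two pieces agreeing to first order. -/
theorem HasDerivAt.ite_ge {f g f' g' : ℝ → ℝ} {c s : ℝ}
    (hf : s ≤ c → HasDerivAt f (f' s) s) (hg : c ≤ s → HasDerivAt g (g' s) s)
    (h : f c = g c) (h' : f' c = g' c) :
    HasDerivAt (fun t => if t ≤ c then f t else g t) (if s ≤ c then f' s else g' s) s := by
  have key := HasDerivAt.ite_le hg hf h.symm h'.symm
  convert key using 1
  · funext t
    rcases lt_trichotomy t c with ht | rfl | ht
    · simp [ht.le, ht.not_ge]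
    · simp [h]
    · simp [ht.le, ht.not_ge]
  · rcases lt_trichotomy s c with ht | rfl | ht
    · simp [ht.le, ht.not_ge]
    · simp [h']
    · simp [ht.le, ht.not_ge]

/-- The derivative of a Taylor polynomial of `F` is the Taylor polynomial of `deriv F`. -/
theorem hasDerivAt_sum_iteratedDeriv_mul_pow (m : ℕ) (F : ℝ → ℝ) (c s : ℝ) :
    HasDerivAt (fun t => ∑ k ∈ Finset.range (m + 1 + 1),
        (1 / (Nat.factorial k : ℝ)) * iteratedDeriv k F c * (t - c) ^ k)
      (∑ k ∈ Finset.range (m + 1),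
        (1 / (Nat.factorial k : ℝ)) * iteratedDeriv k (deriv F) c * (s - c) ^ k) s := by
  simp_rw [Finset.sum_range_succ' _ (m + 1)]
  simp only [pow_zero]
  refine HasDerivAt.add_const _ (HasDerivAt.fun_sum fun k _ => ?_)
  have key := (((hasDerivAt_id s).sub_const c).pow (k + 1)).const_mul
    ((1 / (Nat.factorial (k + 1) : ℝ)) * iteratedDeriv (k + 1) F c)
  refine key.congr_deriv ?_
  have hk : (Nat.factorial k : ℝ) ≠ 0 := by positivity
  have hk' : (k : ℝ) + 1 ≠ 0 := by positivity
  rw [iteratedDeriv_succ', Nat.factorial_succ]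
  push_cast
  simp only [id]
  field_simp

theorem sum_iteratedDeriv_mul_pow_self (m : ℕ) (F : ℝ → ℝ) (c : ℝ) :
    ∑ k ∈ Finset.range (m + 1),
      (1 / (Nat.factorial k : ℝ)) * iteratedDeriv k F c * (c - c) ^ k = F c := by
  rw [Finset.sum_range_succ']
  simp

theorem hasDerivAt_approxPot (m : ℕ) {F : ℝ → ℝ} (hF : DifferentiableOn ℝ F (Set.Ioo (-1) 1))
    {ε : ℝ} (hε : ε ∈ Set.Ioo (0 : ℝ) 1) (s : ℝ) :
    HasDerivAt (approxPot (m + 1) F ε) (approxPot m (deriv F) ε s) s := by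
  obtain ⟨hε0, hε1⟩ := hε
  have hc : ¬ (1 - ε ≤ -(1 - ε)) := by linarith
  have hc' : -(1 - ε) = -1 + ε := by ring
  rw [hc'] at hc
  unfold approxPot
  simp only [hc']
  refine HasDerivAt.ite_le
    (f' := fun s => ∑ k ∈ Finset.range (m + 1),
      (1 / (Nat.factorial k : ℝ)) * iteratedDeriv k (deriv F) (1 - ε) * (s - (1 - ε)) ^ k)
    (g' := fun s => if s ≤ -1 + ε then ∑ k ∈ Finset.range (m + 1),
      (1 / (Nat.factorial k : ℝ)) * iteratedDeriv k (deriv F) (-1 + ε) * (s - (-1 + ε)) ^ k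
      else deriv F s)
    (fun _ => hasDerivAt_sum_iteratedDeriv_mul_pow m F _ s) (fun hs => ?_) ?_ ?_
  · refine HasDerivAt.ite_ge (f' := fun s => ∑ k ∈ Finset.range (m + 1),
        (1 / (Nat.factorial k : ℝ)) * iteratedDeriv k (deriv F) (-1 + ε) * (s - (-1 + ε)) ^ k)
      (fun _ => hasDerivAt_sum_iteratedDeriv_mul_pow m F _ s) (fun hs' => ?_)
      (sum_iteratedDeriv_mul_pow_self _ _ _) (sum_iteratedDeriv_mul_pow_self _ _ _)
    exact (hF.differentiableAt (Ioo_mem_nhds (by linarith) (by linarith))).hasDerivAt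
  · rw [if_neg hc]
    exact sum_iteratedDeriv_mul_pow_self _ _ _
  · simp only [if_neg hc]
    exact sum_iteratedDeriv_mul_pow_self _ _ _

theorem iteratedDeriv_two_approxPot (m : ℕ) {F : ℝ → ℝ}
    (hF : ContDiffOn ℝ 2 F (Set.Ioo (-1) 1)) {ε : ℝ} (hε : ε ∈ Set.Ioo (0 : ℝ) 1) :
    iteratedDeriv 2 (approxPot (m + 2) F ε) = approxPot m (iteratedDeriv 2 F) ε := by
  have h1 : deriv (approxPot (m + 2) F ε) = approxPot (m + 1) (deriv F) ε :=
    funext fun s => (hasDerivAt_approxPot (m + 1) (hF.differentiableOn two_ne_zero) hε s).deriv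
  have hF' : DifferentiableOn ℝ (deriv F) (Set.Ioo (-1) 1) :=
    (hF.deriv_of_isOpen (m := 1) isOpen_Ioo (by norm_num)).differentiableOn one_ne_zero
  simp only [iteratedDeriv_succ, iteratedDeriv_zero, h1]
  exact funext fun s => (hasDerivAt_approxPot m hF' hε s).deriv

theorem le_sum_iteratedDeriv_mul_pow (m : ℕ) (F : ℝ → ℝ) (c s : ℝ)
    (h : ∀ k < m, 0 ≤ iteratedDeriv (k + 1) F c * (s - c) ^ (k + 1)) :
    F c ≤ ∑ k ∈ Finset.range (m + 1),
      (1 / (Nat.factorial k : ℝ)) * iteratedDeriv k F c * (s - c) ^ k := by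
  rw [Finset.sum_range_succ']
  simp only [Nat.factorial_zero, Nat.cast_one, div_one, iteratedDeriv_zero, pow_zero, one_mul,
    mul_one, le_add_iff_nonneg_left]
  refine Finset.sum_nonneg fun k hk => ?_
  rw [mul_assoc]
  exact mul_nonneg (by positivity) (h k (Finset.mem_range.1 hk))

theorem stmt3
    {Ω : Type*} [MeasurableSpace Ω] (μ : MeasureTheory.Measure Ω)
    (q : ℕ) (hq : 0 < q) (n : ℕ) (hn : n = 2 + 2 * q)
    (F₁ : ℝ → ℝ) (hF₁ : ContDiffOn ℝ n F₁ (Set.Ioo (-1 : ℝ) 1))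
    -- (A4)
    (ε₀ : ℝ) (hε₀ : ε₀ ∈ Set.Ioo (0 : ℝ) 1)
    (hA4₁ : ∀ k ≤ n, ∀ s ∈ Set.Ico (1 - ε₀) (1 : ℝ), 0 ≤ iteratedDeriv k F₁ s)
    (hA4₂ : ∀ j ≤ q, ∀ s ∈ Set.Ioc (-1 : ℝ) (-1 + ε₀),
      0 ≤ iteratedDeriv (2 * j + 2) F₁ s)
    (hA4₃ : ∀ j ≤ q, ∀ s ∈ Set.Ioc (-1 : ℝ) (-1 + ε₀),
      iteratedDeriv (2 * j + 1) F₁ s ≤ 0)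
    (α β γ : ℝ) (hsum : 0 < α + β + γ)
    (hα : ∀ s ∈ Set.Ioo (-1 : ℝ) 1, α ≤ iteratedDeriv 2 F₁ s)
    (F₂ : ℝ → ℝ) (hF₂ : Differentiable ℝ F₂) (hF₂' : Differentiable ℝ (deriv F₂))
    (hγ : ∀ s : ℝ, γ ≤ deriv (deriv F₂) s)
    (a : Ω → ℝ) (ha : Measurable a) (haβ : ∀ᵐ x ∂μ, β ≤ a x)
    (c₀ : ℝ) (hc₀ : c₀ = α + β + γ) :
    ∃ ε₁ : ℝ, ε₁ ∈ Set.Ioo (0 : ℝ) 1 ∧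
      ∀ ε ∈ Set.Ioc (0 : ℝ) ε₁, ∀ s : ℝ, ∀ᵐ x ∂μ,
        c₀ ≤ iteratedDeriv 2 (approxPot n F₁ ε) s + deriv (deriv F₂) s + a x := by
  refine ⟨ε₀, hε₀, fun ε hε s => ?_⟩
  obtain ⟨hε0, hεε₀⟩ := hε
  have hε1 : ε < 1 := hεε₀.trans_lt hε₀.2
  have hF₁2 : ContDiffOn ℝ 2 F₁ (Set.Ioo (-1) 1) :=
    hF₁.of_le (by rw [hn]; exact_mod_cast Nat.le_add_right 2 (2 * q))
  have hiter : ∀ k, iteratedDeriv k (iteratedDeriv 2 F₁) = iteratedDeriv (k + 2) F₁ := fun k => by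
    simp only [iteratedDeriv_succ', iteratedDeriv_zero]
  have key : α ≤ iteratedDeriv 2 (approxPot n F₁ ε) s := by
    rw [show n = 2 * q + 2 by omega, iteratedDeriv_two_approxPot _ hF₁2 ⟨hε0, hε1⟩]
    unfold approxPot
    split_ifs with h1 h2
    · refine (hα (1 - ε) ⟨by linarith, by linarith⟩).trans
        (le_sum_iteratedDeriv_mul_pow _ _ _ _ fun k hk => ?_)
      rw [hiter]
      exact mul_nonneg (hA4₁ _ (by omega) _ ⟨by linarith, by linarith⟩)
        (pow_nonneg (by linarith) _)
    · refine (hα (-1 + ε) ⟨by linarith, by linarith⟩).trans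
        (le_sum_iteratedDeriv_mul_pow _ _ _ _ fun k hk => ?_)
      rw [hiter]
      have hmem : -1 + ε ∈ Set.Ioc (-1 : ℝ) (-1 + ε₀) := ⟨by linarith, by linarith⟩
      rcases Nat.even_or_odd (k + 1) with hk' | hk'
      · obtain ⟨j, hj⟩ := hk'
        rw [show k + 1 + 2 = 2 * j + 2 by omega]
        exact mul_nonneg (hA4₂ j (by omega) _ hmem) (Even.pow_nonneg ⟨j, hj⟩ _)
      · obtain ⟨j, hj⟩ := id hk'
        rw [show k + 1 + 2 = 2 * (j + 1) + 1 by omega]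
        exact mul_nonneg_of_nonpos_of_nonpos (hA4₃ (j + 1) (by omega) _ hmem)
          (hk'.pow_nonpos (by linarith))
    · exact hα s ⟨by linarith, by linarith⟩
  filter_upwards [haβ] with x hx
  linarith [hγ s]
end

section
/- Assume (A5): there exists ε₀ ∈ (0,1) such that F₁⁽ⁿ⁾ is nondecreasing on [1−ε₀,1) and nonincreasing on (−1,−1+ε₀]. Then for every ε ∈ (0,ε₀] and every s ∈ (−1,1) one has F₁ε(s) ≤ F₁(s). -/
open Set in
/-- Taylor's theorem with Lagrange remainder, recentred so that the polynomial has the same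
order as the derivative in the remainder. -/
theorem exists_sub_taylor_eq {f : ℝ → ℝ} {a x : ℝ} {n : ℕ} (hn : n ≠ 0) (hx : a ≠ x)
    (hf : ∀ y ∈ uIcc a x, ContDiffAt ℝ n f y) :
    ∃ c ∈ uIoo a x, f x - ∑ k ∈ Finset.range (n + 1),
        (1 / (Nat.factorial k : ℝ)) * iteratedDeriv k f a * (x - a) ^ k =
      (iteratedDeriv n f c - iteratedDeriv n f a) * (x - a) ^ n / (Nat.factorial n : ℝ) := by
  obtain ⟨m, rfl⟩ := Nat.exists_eq_succ_of_ne_zero hn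
  have hu : UniqueDiffOn ℝ (uIcc a x) := uniqueDiffOn_uIcc hx
  have hfon : ContDiffOn ℝ (m + 1 : ℕ) f (uIcc a x) := fun y hy => (hf y hy).contDiffWithinAt
  have hd : ∀ k ≤ m + 1, ∀ y ∈ uIcc a x,
      iteratedDerivWithin k f (uIcc a x) y = iteratedDeriv k f y := fun k hk y hy =>
    iteratedDerivWithin_eq_iteratedDeriv hu ((hf y hy).of_le (by exact_mod_cast hk)) hy
  obtain ⟨c, hc, h⟩ := taylor_mean_remainder_lagrange (n := m) hx
    (hfon.of_le (by exact_mod_cast m.le_succ))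
    ((hfon.differentiableOn_iteratedDerivWithin (by exact_mod_cast m.lt_succ_self) hu).mono
      Ioo_subset_Icc_self)
  refine ⟨c, hc, ?_⟩
  rw [hd _ le_rfl c (Ioo_subset_Icc_self hc), taylor_within_apply] at h
  have hsum : ∑ k ∈ Finset.range (m + 1),
        (1 / (Nat.factorial k : ℝ)) * iteratedDeriv k f a * (x - a) ^ k =
      ∑ k ∈ Finset.range (m + 1),
        ((Nat.factorial k : ℝ)⁻¹ * (x - a) ^ k) • iteratedDerivWithin k f (uIcc a x) a := by
    refine Finset.sum_congr rfl fun k hk => ?_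
    rw [hd k (Finset.mem_range.1 hk).le a left_mem_uIcc, smul_eq_mul]
    ring
  rw [Nat.succ_eq_add_one, Finset.sum_range_succ, hsum, ← sub_sub, h]
  ring

open Set in
/-- A Taylor polynomial of even order lies below the function at `x` when the top derivative
between `a` and `x` is at least its value at `a`. -/
theorem taylor_le_of_even {f : ℝ → ℝ} {a x : ℝ} {n : ℕ} (hn : n ≠ 0) (hev : Even n)
    (hf : ∀ y ∈ uIcc a x, ContDiffAt ℝ n f y)
    (hle : ∀ y ∈ uIoo a x, iteratedDeriv n f a ≤ iteratedDeriv n f y) :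
    ∑ k ∈ Finset.range (n + 1),
      (1 / (Nat.factorial k : ℝ)) * iteratedDeriv k f a * (x - a) ^ k ≤ f x := by
  rcases eq_or_ne a x with rfl | hx
  · simp [Finset.sum_range_succ']
  · obtain ⟨c, hc, h⟩ := exists_sub_taylor_eq hn hx hf
    have hpow : 0 ≤ (x - a) ^ n := hev.pow_nonneg _
    have hnonneg : 0 ≤ (iteratedDeriv n f c - iteratedDeriv n f a) * (x - a) ^ n /
        (Nat.factorial n : ℝ) :=
      div_nonneg (mul_nonneg (sub_nonneg.2 (hle c hc)) hpow) (Nat.cast_nonneg _)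
    linarith

theorem stmt4
    (q : ℕ) (hq : 0 < q) (n : ℕ) (hn : n = 2 + 2 * q)
    (F₁ : ℝ → ℝ) (hF₁ : ContDiffOn ℝ n F₁ (Set.Ioo (-1 : ℝ) 1))
    -- (A5)
    (ε₀ : ℝ) (hε₀ : ε₀ ∈ Set.Ioo (0 : ℝ) 1)
    (hA5₁ : MonotoneOn (iteratedDeriv n F₁) (Set.Ico (1 - ε₀) (1 : ℝ)))
    (hA5₂ : AntitoneOn (iteratedDeriv n F₁) (Set.Ioc (-1 : ℝ) (-1 + ε₀))) :
    ∀ ε ∈ Set.Ioc (0 : ℝ) ε₀, ∀ s ∈ Set.Ioo (-1 : ℝ) 1,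
      approxPot n F₁ ε s ≤ F₁ s := by
  rintro ε ⟨hε, hεε₀⟩ s ⟨hs₁, hs₂⟩
  obtain ⟨hε₀pos, hε₀lt⟩ := hε₀
  have hn0 : n ≠ 0 := by omega
  have hev : Even n := ⟨1 + q, by omega⟩
  have hcd : ∀ a ∈ Set.Ioo (-1 : ℝ) 1, ∀ y ∈ Set.uIcc a s, ContDiffAt ℝ n F₁ y :=
    fun a ha y hy => hF₁.contDiffAt
      (isOpen_Ioo.mem_nhds (Set.ordConnected_Ioo.uIcc_subset ha ⟨hs₁, hs₂⟩ hy))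
  unfold approxPot
  split_ifs with h₁ h₂
  · refine taylor_le_of_even hn0 hev (hcd _ ⟨by linarith, by linarith⟩) fun y hy => ?_
    rw [Set.uIoo_of_le h₁] at hy
    exact hA5₁ ⟨by linarith, by linarith⟩ ⟨by linarith [hy.1], by linarith [hy.2]⟩ hy.1.le
  · refine taylor_le_of_even hn0 hev (hcd _ ⟨by linarith, by linarith⟩) fun y hy => ?_
    rw [Set.uIoo_of_ge (by linarith)] at hy
    exact hA5₂ ⟨by linarith [hy.1], by linarith [hy.2]⟩ ⟨by linarith, by linarith⟩ hy.2.le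
  · exact le_rfl
end

section
/- Assume (A4): there exists ε₀ ∈ (0,1) such that F₁⁽ᵏ⁾(s) ≥ 0 for all s ∈ [1−ε₀,1) and all k = 0,1,…,n, and F₁⁽²ʲ⁺²⁾(s) ≥ 0 and F₁⁽²ʲ⁺¹⁾(s) ≤ 0 for all s ∈ (−1,−1+ε₀] and all j = 0,1,…,q; (A5): there exists ε₀ ∈ (0,1) such that F₁⁽ⁿ⁾ is nondecreasing on [1−ε₀,1) and nonincreasing on (−1,−1+ε₀]; and (A7): F₁'(s) → +∞ as s → 1⁻ and F₁'(s) → −∞ as s → −1⁺. Then there exists ε₁ ∈ (0,1) such that for every ε ∈ (0,ε₁] and every s ∈ (−1,1) one has |F₁ε'(s)| ≤ |F₁'(s)|. -/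
/-- Derivative of a polynomial written in Taylor form. -/
theorem hasDerivAt_taylorSum_s5 (c : ℕ → ℝ) (N : ℕ) (a s : ℝ) :
    HasDerivAt
      (fun x => ∑ k ∈ Finset.range (N + 1), (1 / (Nat.factorial k : ℝ)) * c k * (x - a) ^ k)
      (∑ k ∈ Finset.range N, (1 / (Nat.factorial k : ℝ)) * c (k + 1) * (s - a) ^ k) s := by
  have hterm : ∀ k ∈ Finset.range (N + 1),
      HasDerivAt (fun x => (1 / (Nat.factorial k : ℝ)) * c k * (x - a) ^ k)
        ((1 / (Nat.factorial k : ℝ)) * c k * ((k : ℝ) * (s - a) ^ (k - 1) * 1)) s :=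
    fun k _ => (((hasDerivAt_id s).sub_const a).pow k).const_mul _
  refine (HasDerivAt.fun_sum hterm).congr_deriv ?_
  rw [Finset.sum_range_succ']
  simp only [Nat.cast_zero, zero_mul, mul_zero, add_zero]
  refine Finset.sum_congr rfl fun k _ => ?_
  have hk : ((k : ℝ) + 1) ≠ 0 := by positivity
  have hf : (Nat.factorial k : ℝ) ≠ 0 := by positivity
  rw [Nat.factorial_succ, Nat.add_sub_cancel]
  push_cast
  field_simp

/-- Taylor's formula with Lagrange remainder for the derivative of a function on an open set. -/
theorem exists_deriv_eq_taylorSum_add_remainder {f : ℝ → ℝ} {U : Set ℝ} {m : ℕ} (hU : IsOpen U)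
    (hf : ContDiffOn ℝ ((m + 2 : ℕ) : WithTop ℕ∞) f U) {a s : ℝ} (h : Set.uIcc a s ⊆ U) :
    ∃ ξ ∈ Set.uIcc a s, deriv f s =
      (∑ k ∈ Finset.range (m + 1),
        (1 / (Nat.factorial k : ℝ)) * iteratedDeriv (k + 1) f a * (s - a) ^ k) +
      (1 / (Nat.factorial (m + 1) : ℝ)) * iteratedDeriv (m + 2) f ξ * (s - a) ^ (m + 1) := by
  rcases eq_or_ne a s with rfl | hne
  · refine ⟨a, Set.left_mem_uIcc, ?_⟩
    rw [Finset.sum_range_succ']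
    simp
  have hd : ContDiffOn ℝ ((m : WithTop ℕ∞) + 1) (deriv f) U :=
    hf.deriv_of_isOpen hU (by push_cast; rw [add_assoc]; norm_num)
  obtain ⟨ξ, hξ, he⟩ := taylor_mean_remainder_lagrange_iteratedDeriv hne (hd.mono h)
  refine ⟨ξ, Set.uIoo_subset_uIcc_self hξ, ?_⟩
  rw [sub_eq_iff_eq_add'] at he
  rw [he, taylor_within_apply]
  congr 1
  · refine Finset.sum_congr rfl fun k hk => ?_
    have hda : ContDiffAt ℝ k (deriv f) a :=
      ((hd.contDiffAt (hU.mem_nhds (h Set.left_mem_uIcc))).of_le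
        (by exact_mod_cast (Finset.mem_range.1 hk).le))
    rw [iteratedDerivWithin_eq_iteratedDeriv (uniqueDiffOn_uIcc hne) hda Set.left_mem_uIcc,
      iteratedDeriv_succ', smul_eq_mul]
    ring
  · rw [← iteratedDeriv_succ']
    ring

/-- If two functions agree on a set having `s` as a point of unique differentiability and the second
is differentiable at `s`, then the first has at `s` either the same derivative or none. -/
theorem abs_deriv_le_of_eqOn {f g : ℝ → ℝ} {t : Set ℝ} {s g' : ℝ} (hu : UniqueDiffWithinAt ℝ t s)
    (hs : s ∈ t) (h : Set.EqOn f g t) (hg : HasDerivAt g g' s) : |deriv f s| ≤ |g'| := by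
  by_cases hf : DifferentiableAt ℝ f s
  · have h1 : HasDerivWithinAt g (deriv f s) t s :=
      hf.hasDerivAt.hasDerivWithinAt.congr (fun x hx => (h hx).symm) (h hs).symm
    rw [hu.eq_deriv t h1 hg.hasDerivWithinAt]
  · rw [deriv_zero_of_not_differentiableAt hf]
    simp

theorem stmt5
    (q : ℕ) (hq : 0 < q) (n : ℕ) (hn : n = 2 + 2 * q)
    (F₁ : ℝ → ℝ) (hF₁ : ContDiffOn ℝ n F₁ (Set.Ioo (-1 : ℝ) 1))
    -- (A4)
    (ε₀ : ℝ) (hε₀ : ε₀ ∈ Set.Ioo (0 : ℝ) 1)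
    (hA4₁ : ∀ k ≤ n, ∀ s ∈ Set.Ico (1 - ε₀) (1 : ℝ), 0 ≤ iteratedDeriv k F₁ s)
    (hA4₂ : ∀ j ≤ q, ∀ s ∈ Set.Ioc (-1 : ℝ) (-1 + ε₀),
      0 ≤ iteratedDeriv (2 * j + 2) F₁ s)
    (hA4₃ : ∀ j ≤ q, ∀ s ∈ Set.Ioc (-1 : ℝ) (-1 + ε₀),
      iteratedDeriv (2 * j + 1) F₁ s ≤ 0)
    -- (A5)
    (ε₀'' : ℝ) (hε₀'' : ε₀'' ∈ Set.Ioo (0 : ℝ) 1)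
    (hA5₁ : MonotoneOn (iteratedDeriv n F₁) (Set.Ico (1 - ε₀'') (1 : ℝ)))
    (hA5₂ : AntitoneOn (iteratedDeriv n F₁) (Set.Ioc (-1 : ℝ) (-1 + ε₀'')))
    -- (A7)
    (hA7₁ : Filter.Tendsto (deriv F₁) (nhdsWithin 1 (Set.Iio 1)) Filter.atTop)
    (hA7₂ : Filter.Tendsto (deriv F₁) (nhdsWithin (-1) (Set.Ioi (-1))) Filter.atBot) :
    ∃ ε₁ : ℝ, ε₁ ∈ Set.Ioo (0 : ℝ) 1 ∧
      ∀ ε ∈ Set.Ioc (0 : ℝ) ε₁, ∀ s ∈ Set.Ioo (-1 : ℝ) 1,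
        |deriv (approxPot n F₁ ε) s| ≤ |deriv F₁ s| := by
  obtain rfl : n = 2 * q + 2 := by omega
  refine ⟨min ε₀ ε₀'', ⟨lt_min hε₀.1 hε₀''.1, (min_le_left _ _).trans_lt hε₀.2⟩, ?_⟩
  rintro ε ⟨hε, hεle⟩ s ⟨hs₁, hs₂⟩
  have hle₀ : ε ≤ ε₀ := hεle.trans (min_le_left _ _)
  have hle₁ : ε ≤ ε₀'' := hεle.trans (min_le_right _ _)
  have hε1 : ε < 1 := hle₀.trans_lt hε₀.2
  rcases le_or_gt (1 - ε) s with hr | hr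
  · have heq : Set.EqOn (approxPot (2 * q + 2) F₁ ε) (fun x =>
        ∑ k ∈ Finset.range (2 * q + 2 + 1),
          (1 / (Nat.factorial k : ℝ)) * iteratedDeriv k F₁ (1 - ε) * (x - (1 - ε)) ^ k)
        (Set.Ici s) := fun x hx => if_pos (hr.trans hx)
    refine (abs_deriv_le_of_eqOn (uniqueDiffOn_Ici s s Set.self_mem_Ici) Set.self_mem_Ici heq
      (hasDerivAt_taylorSum_s5 (fun k => iteratedDeriv k F₁ (1 - ε)) _ _ _)).trans ?_
    obtain ⟨ξ, hξ, he⟩ := exists_deriv_eq_taylorSum_add_remainder isOpen_Ioo hF₁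
      (a := 1 - ε) (s := s) (by
        rw [Set.uIcc_of_le hr]
        exact fun x hx => ⟨by linarith [hx.1], by linarith [hx.2]⟩)
    rw [Set.uIcc_of_le hr] at hξ
    have hmono : iteratedDeriv (2 * q + 2) F₁ (1 - ε) ≤ iteratedDeriv (2 * q + 2) F₁ ξ :=
      hA5₁ ⟨by linarith, by linarith⟩ ⟨by linarith [hξ.1], by linarith [hξ.2]⟩ hξ.1
    have hsa : 0 ≤ s - (1 - ε) := sub_nonneg.2 hr
    apply abs_le_abs_of_nonneg
    · refine Finset.sum_nonneg fun k hk => ?_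
      have := hA4₁ (k + 1) (Finset.mem_range.1 hk) (1 - ε) ⟨by linarith, by linarith⟩
      positivity
    · rw [Finset.sum_range_succ, he]
      gcongr
  rcases le_or_gt s (-(1 - ε)) with hl | hl
  · have hl' : s ≤ -1 + ε := by linarith
    have heq : Set.EqOn (approxPot (2 * q + 2) F₁ ε) (fun x =>
        ∑ k ∈ Finset.range (2 * q + 2 + 1),
          (1 / (Nat.factorial k : ℝ)) * iteratedDeriv k F₁ (-1 + ε) * (x - (-1 + ε)) ^ k)
        (Set.Iic s) := fun x hx => by
      have hx' : x ≤ s := hx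
      simp only [approxPot]
      rw [if_neg (by linarith), if_pos (by linarith)]
    refine (abs_deriv_le_of_eqOn (uniqueDiffOn_Iic s s Set.self_mem_Iic) Set.self_mem_Iic heq
      (hasDerivAt_taylorSum_s5 (fun k => iteratedDeriv k F₁ (-1 + ε)) _ _ _)).trans ?_
    obtain ⟨ξ, hξ, he⟩ := exists_deriv_eq_taylorSum_add_remainder isOpen_Ioo hF₁
      (a := -1 + ε) (s := s) (by
        rw [Set.uIcc_of_ge hl']
        exact fun x hx => ⟨by linarith [hx.1], by linarith [hx.2]⟩)
    rw [Set.uIcc_of_ge hl'] at hξ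
    have hmono : iteratedDeriv (2 * q + 2) F₁ (-1 + ε) ≤ iteratedDeriv (2 * q + 2) F₁ ξ :=
      hA5₂ ⟨by linarith [hξ.1], by linarith [hξ.2]⟩ ⟨by linarith, by linarith⟩ hξ.2
    have hsa : s - (-1 + ε) ≤ 0 := sub_nonpos.2 hl'
    apply abs_le_abs_of_nonpos
    · refine Finset.sum_nonpos fun k hk => ?_
      have hk' := Finset.mem_range.1 hk
      have hfac : (0 : ℝ) ≤ 1 / (Nat.factorial k : ℝ) := by positivity
      rcases Nat.even_or_odd' k with ⟨j, rfl | rfl⟩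
      · exact mul_nonpos_of_nonpos_of_nonneg
          (mul_nonpos_of_nonneg_of_nonpos hfac
            (hA4₃ j (by omega) _ ⟨by linarith, by linarith⟩))
          (Even.pow_nonneg ⟨j, by ring⟩ _)
      · exact mul_nonpos_of_nonneg_of_nonpos
          (mul_nonneg hfac (hA4₂ j (by omega) _ ⟨by linarith, by linarith⟩))
          (Odd.pow_nonpos ⟨j, rfl⟩ hsa)
    · rw [Finset.sum_range_succ, he]
      have hpow : (s - (-1 + ε)) ^ (2 * q + 1) ≤ 0 := Odd.pow_nonpos ⟨q, rfl⟩ hsa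
      refine add_le_add le_rfl (mul_le_mul_of_nonpos_right ?_ hpow)
      gcongr
  · have heq : approxPot (2 * q + 2) F₁ ε =ᶠ[nhds s] F₁ := by
      filter_upwards [Ioo_mem_nhds hl hr] with x hx
      simp only [approxPot]
      rw [if_neg (not_le.2 hx.2), if_neg (not_le.2 hx.1)]
    rw [heq.deriv_eq]
end

section
/- Let (Ω,μ) be a measure space with 0 < μ(Ω) < ∞, let ψ ∈ L¹(μ) be real valued, and let g : ℝ → ℝ be a Borel function with g∘ψ ∈ L¹(μ). Let m̄ := (1/μ(Ω))·∫_Ω ψ dμ and suppose m₁ < m̄ < m₂ are real numbers such that g(s) ≤ 0 for all s ≤ m₁ and g(s) ≥ 0 for all s ≥ m₂, and such that M := sup_{s ∈ [m₁,m₂]} |g(s)| is finite. Set δ := min(m̄−m₁, m₂−m̄), δ₁ := max(m̄−m₁, m₂−m̄), and ḡ := (1/μ(Ω))·∫_Ω g(ψ) dμ. Then δ·∫_Ω |g(ψ)| dμ ≤ ∫_Ω (ψ−m̄)·(g(ψ)−ḡ) dμ + (δ+δ₁)·M·μ(Ω). -/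
open MeasureTheory

/-- The pointwise inequality behind the Kenmochi–Niezgódka–Pawłow estimate. -/
theorem mul_abs_le_sub_mul_add_of_sign_outside_Icc {g : ℝ → ℝ} {m m₁ m₂ M d D : ℝ}
    (hm₁ : m₁ < m) (hm₂ : m < m₂)
    (hgneg : ∀ s : ℝ, s ≤ m₁ → g s ≤ 0) (hgpos : ∀ s : ℝ, m₂ ≤ s → 0 ≤ g s)
    (hM : ∀ s ∈ Set.Icc m₁ m₂, |g s| ≤ M)
    (hd : 0 ≤ d) (hd₁ : d ≤ m - m₁) (hd₂ : d ≤ m₂ - m)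
    (hD₁ : m - m₁ ≤ D) (hD₂ : m₂ - m ≤ D) (s : ℝ) :
    d * |g s| ≤ (s - m) * g s + (d + D) * M := by
  have hM0 : 0 ≤ M := (abs_nonneg _).trans (hM m ⟨hm₁.le, hm₂.le⟩)
  have hDM : 0 ≤ (d + D) * M := mul_nonneg (by linarith) hM0
  rcases le_total s m₁ with h₁ | h₁
  · have hg := hgneg s h₁
    rw [abs_of_nonpos hg]
    nlinarith
  rcases le_total m₂ s with h₂ | h₂
  · have hg := hgpos s h₂
    rw [abs_of_nonneg hg]
    nlinarith
  have hgM := hM s ⟨h₁, h₂⟩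
  have hsD : |s - m| ≤ D := abs_le.2 ⟨by linarith, by linarith⟩
  have h₃ : |(s - m) * g s| ≤ D * M := by
    rw [abs_mul]
    exact mul_le_mul hsD hgM (abs_nonneg _) (by linarith)
  have h₄ := mul_le_mul_of_nonneg_left hgM hd
  linarith [neg_abs_le ((s - m) * g s)]

/-- The Kenmochi–Niezgódka–Pawłow estimate. -/
theorem stmt7
    {Ω : Type*} [MeasurableSpace Ω] (μ : Measure Ω)
    (hμ0 : 0 < μ Set.univ) (hμfin : μ Set.univ < ⊤)
    (ψ : Ω → ℝ) (hψ : Integrable ψ μ)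
    (g : ℝ → ℝ) (hg : Measurable g) (hgψ : Integrable (fun x => g (ψ x)) μ)
    (mbar : ℝ) (hmbar : mbar = (μ Set.univ).toReal⁻¹ * ∫ x, ψ x ∂μ)
    (m₁ m₂ : ℝ) (hm₁ : m₁ < mbar) (hm₂ : mbar < m₂)
    (hgneg : ∀ s : ℝ, s ≤ m₁ → g s ≤ 0) (hgpos : ∀ s : ℝ, m₂ ≤ s → 0 ≤ g s)
    (M : ℝ) (hM : ∀ s ∈ Set.Icc m₁ m₂, |g s| ≤ M)
    (δ δ₁ gbar : ℝ)
    (hδ : δ = min (mbar - m₁) (m₂ - mbar))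
    (hδ₁ : δ₁ = max (mbar - m₁) (m₂ - mbar))
    (hgbar : gbar = (μ Set.univ).toReal⁻¹ * ∫ x, g (ψ x) ∂μ)
    (hprod : Integrable (fun x => (ψ x - mbar) * (g (ψ x) - gbar)) μ) :
    δ * ∫ x, |g (ψ x)| ∂μ ≤
      (∫ x, (ψ x - mbar) * (g (ψ x) - gbar) ∂μ) +
        (δ + δ₁) * M * (μ Set.univ).toReal := by
  have : IsFiniteMeasure μ := ⟨hμfin⟩
  have hvol : (μ Set.univ).toReal ≠ 0 := (ENNReal.toReal_pos hμ0.ne' hμfin.ne).ne'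
  have hcenter : Integrable (fun x => (ψ x - mbar) * gbar) μ :=
    (hψ.sub (integrable_const mbar)).mul_const gbar
  have hzero : ∫ x, (ψ x - mbar) * gbar ∂μ = 0 := by
    rw [integral_mul_const, integral_sub hψ (integrable_const mbar), integral_const,
      smul_eq_mul, measureReal_def, hmbar, mul_inv_cancel_left₀ hvol, sub_self, zero_mul]
  have hpoint : ∀ x, δ * |g (ψ x)| ≤
      (ψ x - mbar) * (g (ψ x) - gbar) + (ψ x - mbar) * gbar + (δ + δ₁) * M := fun x => by
    have h := mul_abs_le_sub_mul_add_of_sign_outside_Icc hm₁ hm₂ hgneg hgpos hM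
      (hδ ▸ le_min (by linarith) (by linarith)) (hδ ▸ min_le_left _ _) (hδ ▸ min_le_right _ _)
      (hδ₁ ▸ le_max_left _ _) (hδ₁ ▸ le_max_right _ _) (ψ x)
    linarith
  have hint := integral_mono (hgψ.abs.const_mul δ)
    ((hprod.add hcenter).add (integrable_const ((δ + δ₁) * M))) hpoint
  rw [integral_const_mul, integral_add' (hprod.add hcenter) (integrable_const _),
    integral_add' hprod hcenter, hzero, integral_const, smul_eq_mul, measureReal_def] at hint
  linarith
end

section
/- Let (Ω,μ) be a finite measure space and let φ_j : Ω → ℝ (j ∈ ℕ) be measurable functions with |φ_j(x)| < 1 for μ-a.e. x, converging μ-almost everywhere to a measurable function φ : Ω → ℝ. Let g : (−1,1) → ℝ be a continuous nondecreasing function with g(s) → +∞ as s → 1⁻ and g(s) → −∞ as s → −1⁺, and suppose there exists L < ∞ such that ∫_Ω |g(φ_j(x))| dμ(x) ≤ L for every j. Then |φ(x)| < 1 for μ-a.e. x ∈ Ω. -/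
open MeasureTheory Filter

/-- Composing a measurable function taking values a.e. in a measurable set `s` with a function
continuous on `s` gives an a.e.-measurable function. -/
theorem ContinuousOn.aemeasurable_comp_of_ae_mem {Ω : Type*} [MeasurableSpace Ω] {μ : Measure Ω}
    {g : ℝ → ℝ} {s : Set ℝ} {f : Ω → ℝ} (hg : ContinuousOn g s) (hs : MeasurableSet s)
    (hf : Measurable f) (hfs : ∀ᵐ x ∂μ, f x ∈ s) : AEMeasurable (fun x => g (f x)) μ := by
  classical
  have hmeas : Measurable (s.piecewise g 0) :=
    hg.measurable_piecewise continuousOn_const hs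
  refine ⟨fun x => s.piecewise g 0 (f x), hmeas.comp hf, ?_⟩
  filter_upwards [hfs] with x hx
  exact (Set.piecewise_eq_of_mem s g 0 hx).symm

/-- If the integrals of a sequence of nonnegative functions are bounded by a finite constant, then
almost nowhere does the sequence tend to infinity. -/
theorem MeasureTheory.ae_not_tendsto_top_of_lintegral_le {Ω : Type*} [MeasurableSpace Ω]
    {μ : Measure Ω} {f : ℕ → Ω → ENNReal} (hf : ∀ j, AEMeasurable (f j) μ) {C : ENNReal}
    (hC : C ≠ ⊤) (hfC : ∀ j, ∫⁻ x, f j x ∂μ ≤ C) :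
    ∀ᵐ x ∂μ, ¬ Tendsto (fun j => f j x) atTop (nhds ⊤) := by
  have hfatou : ∫⁻ x, liminf (fun j => f j x) atTop ∂μ ≤ C :=
    (lintegral_liminf_le' hf).trans
      (liminf_le_of_frequently_le' (Frequently.of_forall hfC))
  have hmeas : AEMeasurable (fun x => liminf (fun j => f j x) atTop) μ := by
    refine ⟨fun x => liminf (fun j => (hf j).mk (f j) x) atTop,
      Measurable.liminf fun j => (hf j).measurable_mk, ?_⟩
    filter_upwards [ae_all_iff.mpr fun j => (hf j).ae_eq_mk] with x hx
    simp only [hx]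
  filter_upwards [ae_lt_top' hmeas (ne_top_of_le_ne_top hC hfatou)] with x hx ht
  exact hx.ne ht.liminf_eq

/-- Uniform `L¹` bounds on `g ∘ φⱼ`, where `g` blows up at `±1`, force the a.e.
limit `φ` of the `φⱼ` to satisfy `|φ| < 1` a.e. -/
theorem stmt8
    {Ω : Type*} [MeasurableSpace Ω] (μ : Measure Ω) [IsFiniteMeasure μ]
    (φ : ℕ → Ω → ℝ) (φlim : Ω → ℝ)
    (hφmeas : ∀ j, Measurable (φ j)) (hφlimmeas : Measurable φlim)
    (hφbd : ∀ j, ∀ᵐ x ∂μ, |φ j x| < 1)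
    (hconv : ∀ᵐ x ∂μ, Tendsto (fun j => φ j x) atTop (nhds (φlim x)))
    (g : ℝ → ℝ)
    (hgcont : ContinuousOn g (Set.Ioo (-1 : ℝ) 1))
    (hgmono : MonotoneOn g (Set.Ioo (-1 : ℝ) 1))
    (hgtop : Tendsto g (nhdsWithin 1 (Set.Iio 1)) atTop)
    (hgbot : Tendsto g (nhdsWithin (-1) (Set.Ioi (-1))) atBot)
    (L : ℝ) (hL : ∀ j, ∫⁻ x, ENNReal.ofReal |g (φ j x)| ∂μ ≤ ENNReal.ofReal L) :
    ∀ᵐ x ∂μ, |φlim x| < 1 := by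
  have hmem : ∀ j, ∀ᵐ x ∂μ, φ j x ∈ Set.Ioo (-1 : ℝ) 1 := fun j =>
    (hφbd j).mono fun x hx => abs_lt.mp hx
  have hmeas : ∀ j, AEMeasurable (fun x => ENNReal.ofReal |g (φ j x)|) μ := fun j =>
    (hgcont.aemeasurable_comp_of_ae_mem measurableSet_Ioo (hφmeas j) (hmem j)).abs.ennreal_ofReal
  filter_upwards [ae_all_iff.mpr hmem, hconv,
    ae_not_tendsto_top_of_lintegral_le hmeas ENNReal.ofReal_ne_top hL] with x hx hlim hnot
  have hle : φlim x ≤ 1 := le_of_tendsto' hlim fun j => (hx j).2.le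
  have hge : -1 ≤ φlim x := ge_of_tendsto' hlim fun j => (hx j).1.le
  refine abs_lt.mpr ⟨hge.lt_of_ne fun h => hnot ?_, hle.lt_of_ne fun h => hnot ?_⟩
  · rw [← h] at hlim
    have hwithin : Tendsto (fun j => φ j x) atTop (nhdsWithin (-1) (Set.Ioi (-1))) :=
      tendsto_nhdsWithin_iff.mpr ⟨hlim, Eventually.of_forall fun j => (hx j).1⟩
    exact ENNReal.tendsto_ofReal_atTop.comp
      (tendsto_abs_atBot_atTop.comp (hgbot.comp hwithin))
  · rw [h] at hlim
    have hwithin : Tendsto (fun j => φ j x) atTop (nhdsWithin 1 (Set.Iio 1)) :=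
      tendsto_nhdsWithin_iff.mpr ⟨hlim, Eventually.of_forall fun j => (hx j).2⟩
    exact ENNReal.tendsto_ofReal_atTop.comp
      (tendsto_abs_atTop_atTop.comp (hgtop.comp hwithin))
end

section
/- The logarithmic potential satisfies the sign conditions of assumption (A4) on the whole half-intervals: for every integer k ≥ 0 and every s ∈ [0,1), F₁⁽ᵏ⁾(s) ≥ 0; and for every integer j ≥ 0 and every s ∈ (−1,0], F₁⁽²ʲ⁺²⁾(s) ≥ 0 and F₁⁽²ʲ⁺¹⁾(s) ≤ 0. -/
open Real Set in
theorem hasDerivAt_log_potential (c : ℝ) {s : ℝ} (hs : s ∈ Ioo (-1 : ℝ) 1) :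
    HasDerivAt (fun x ↦ c * ((1 + x) * log (1 + x) + (1 - x) * log (1 - x)))
      (c * (log (1 + s) - log (1 - s))) s := by
  have h₁ : 1 + s ≠ 0 := by linarith [hs.1]
  have h₂ : 1 - s ≠ 0 := by linarith [hs.2]
  have d₁ := (hasDerivAt_mul_log h₁).comp_const_add 1 s
  have d₂ := (hasDerivAt_mul_log h₂).comp_const_sub 1 s
  exact ((d₁.add d₂).const_mul c).congr_deriv (by ring)

open Real Set in
theorem hasDerivAt_log_sub_log (c : ℝ) {s : ℝ} (hs : s ∈ Ioo (-1 : ℝ) 1) :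
    HasDerivAt (fun x ↦ c * (log (1 + x) - log (1 - x)))
      (c * ((1 + s)⁻¹ + (1 - s)⁻¹)) s := by
  have h₁ : 1 + s ≠ 0 := by linarith [hs.1]
  have h₂ : 1 - s ≠ 0 := by linarith [hs.2]
  have d₁ := (hasDerivAt_log h₁).comp_const_add 1 s
  have d₂ := (hasDerivAt_log h₂).comp_const_sub 1 s
  exact ((d₁.sub d₂).const_mul c).congr_deriv (by ring)

open Set in
theorem hasDerivAt_inv_pow_add_inv_pow (c : ℝ) (n : ℕ) {s : ℝ} (hs : s ∈ Ioo (-1 : ℝ) 1) :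
    HasDerivAt
      (fun x ↦ c * n.factorial * ((-1) ^ n * (1 + x)⁻¹ ^ (n + 1) + (1 - x)⁻¹ ^ (n + 1)))
      (c * (n + 1).factorial *
        ((-1) ^ (n + 1) * (1 + s)⁻¹ ^ (n + 2) + (1 - s)⁻¹ ^ (n + 2))) s := by
  have h₁ : 1 + s ≠ 0 := by linarith [hs.1]
  have h₂ : 1 - s ≠ 0 := by linarith [hs.2]
  have d₁ := ((hasDerivAt_inv h₁).comp_const_add 1 s).fun_pow (n + 1)
  have d₂ := ((hasDerivAt_inv h₂).comp_const_sub 1 s).fun_pow (n + 1)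
  refine (((d₁.const_mul ((-1) ^ n)).fun_add d₂).const_mul (c * n.factorial)).congr_deriv ?_
  simp only [Nat.factorial_succ, Nat.add_sub_cancel, ← inv_pow]
  push_cast
  ring

open Real Set in
theorem iteratedDeriv_one_log_potential (c : ℝ) {s : ℝ} (hs : s ∈ Ioo (-1 : ℝ) 1) :
    iteratedDeriv 1 (fun x ↦ c * ((1 + x) * log (1 + x) + (1 - x) * log (1 - x))) s =
      c * (log (1 + s) - log (1 - s)) := by
  rw [iteratedDeriv_one, (hasDerivAt_log_potential c hs).deriv]

open Real Set in
theorem iteratedDeriv_add_two_log_potential (c : ℝ) (n : ℕ) {s : ℝ} (hs : s ∈ Ioo (-1 : ℝ) 1) :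
    iteratedDeriv (n + 2) (fun x ↦ c * ((1 + x) * log (1 + x) + (1 - x) * log (1 - x))) s =
      c * n.factorial * ((-1) ^ n * (1 + s)⁻¹ ^ (n + 1) + (1 - s)⁻¹ ^ (n + 1)) := by
  induction n generalizing s with
  | zero =>
    rw [iteratedDeriv_succ, Filter.EventuallyEq.deriv_eq
      (Filter.eventuallyEq_of_mem (isOpen_Ioo.mem_nhds hs)
        fun x hx ↦ iteratedDeriv_one_log_potential c hx), (hasDerivAt_log_sub_log c hs).deriv]
    simp
  | succ n ih =>
    rw [iteratedDeriv_succ, Filter.EventuallyEq.deriv_eq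
      (Filter.eventuallyEq_of_mem (isOpen_Ioo.mem_nhds hs) fun x hx ↦ ih hx),
      (hasDerivAt_inv_pow_add_inv_pow c n hs).deriv]

theorem Real.sub_one_le_mul_log {x : ℝ} (hx : 0 < x) : x - 1 ≤ x * Real.log x := by
  have h := mul_le_mul_of_nonneg_left (Real.one_sub_inv_le_log_of_pos hx) hx.le
  rwa [mul_sub, mul_one, mul_inv_cancel₀ hx.ne'] at h

open Real Set in
theorem iteratedDeriv_log_potential_nonneg {c : ℝ} (hc : 0 ≤ c) (k : ℕ) {s : ℝ}
    (hs : s ∈ Ico (0 : ℝ) 1) :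
    0 ≤ iteratedDeriv k (fun x ↦ c * ((1 + x) * log (1 + x) + (1 - x) * log (1 - x))) s := by
  obtain ⟨h0, h1⟩ := hs
  have hs' : s ∈ Ioo (-1 : ℝ) 1 := ⟨by linarith, h1⟩
  have hp : 0 < 1 + s := by linarith
  have hm : 0 < 1 - s := by linarith
  match k with
  | 0 =>
    rw [iteratedDeriv_zero]
    exact mul_nonneg hc (by linarith [Real.sub_one_le_mul_log hp, Real.sub_one_le_mul_log hm])
  | 1 =>
    rw [iteratedDeriv_one_log_potential c hs']
    exact mul_nonneg hc (sub_nonneg.2 (log_le_log hm (by linarith)))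
  | n + 2 =>
    rw [iteratedDeriv_add_two_log_potential c n hs']
    refine mul_nonneg (by positivity) ?_
    have hle : (1 + s)⁻¹ ^ (n + 1) ≤ (1 - s)⁻¹ ^ (n + 1) :=
      pow_le_pow_left₀ (by positivity) (inv_anti₀ hm (by linarith)) _
    have hpos : 0 < (1 + s)⁻¹ ^ (n + 1) := by positivity
    rcases neg_one_pow_eq_or ℝ n with h | h <;> rw [h] <;> linarith

theorem stmt13
    (θ : ℝ) (hθ : 0 < θ) (F₁ : ℝ → ℝ)
    (hF₁ : ∀ s : ℝ,
      F₁ s = θ / 2 * ((1 + s) * Real.log (1 + s) + (1 - s) * Real.log (1 - s))) :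
    (∀ k : ℕ, ∀ s ∈ Set.Ico (0 : ℝ) 1, 0 ≤ iteratedDeriv k F₁ s) ∧
    (∀ j : ℕ, ∀ s ∈ Set.Ioc (-1 : ℝ) 0,
      0 ≤ iteratedDeriv (2 * j + 2) F₁ s ∧ iteratedDeriv (2 * j + 1) F₁ s ≤ 0) := by
  have hnonneg : ∀ k : ℕ, ∀ s ∈ Set.Ico (0 : ℝ) 1, 0 ≤ iteratedDeriv k F₁ s := by
    intro k s hs
    rw [funext hF₁]
    exact iteratedDeriv_log_potential_nonneg (by positivity) k hs
  have heven : (fun x ↦ F₁ (-x)) = F₁ := by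
    funext x
    rw [hF₁, hF₁, sub_neg_eq_add, ← sub_eq_add_neg, add_comm ((1 - x) * _)]
  have hreflect (k : ℕ) (s : ℝ) :
      iteratedDeriv k F₁ s = (-1) ^ k * iteratedDeriv k F₁ (-s) := by
    have h := iteratedDeriv_comp_neg k F₁ s
    rwa [heven, smul_eq_mul] at h
  refine ⟨hnonneg, fun j s hs ↦ ?_⟩
  have hs' : -s ∈ Set.Ico (0 : ℝ) 1 := ⟨by linarith [hs.2], by linarith [hs.1]⟩
  rw [hreflect (2 * j + 2), hreflect (2 * j + 1), Even.neg_one_pow (by simp [parity_simps]),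
    Odd.neg_one_pow (by simp [parity_simps])]
  exact ⟨by linarith [hnonneg (2 * j + 2) _ hs'], by linarith [hnonneg (2 * j + 1) _ hs']⟩
end

section
/- For every positive integer q, the derivative of order 2+2q of the logarithmic potential, s ↦ F₁⁽²⁺²ᑫ⁾(s), is nondecreasing on [0,1) and nonincreasing on (−1,0]. Hence the logarithmic potential satisfies assumption (A5). -/
/-- The logarithmic potential with parameter `θ`. -/
noncomputable def logPotential (θ s : ℝ) : ℝ :=
  θ / 2 * ((1 + s) * Real.log (1 + s) + (1 - s) * Real.log (1 - s))

/-- The closed form of the derivative of order `m + 2` of the logarithmic potential. -/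
noncomputable def logPotentialDeriv (θ : ℝ) (m : ℕ) (s : ℝ) : ℝ :=
  θ / 2 * m.factorial * ((-1) ^ m * ((1 + s)⁻¹) ^ (m + 1) + ((1 - s)⁻¹) ^ (m + 1))

theorem hasDerivAt_logPotential (θ : ℝ) {s : ℝ} (hs : s ∈ Set.Ioo (-1 : ℝ) 1) :
    HasDerivAt (logPotential θ) (θ / 2 * (Real.log (1 + s) - Real.log (1 - s))) s := by
  have hp : 1 + s ≠ 0 := by linarith [hs.1]
  have hm : 1 - s ≠ 0 := by linarith [hs.2]
  have h1 : HasDerivAt (fun x : ℝ => 1 + x) 1 s := (hasDerivAt_id s).const_add 1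
  have h2 : HasDerivAt (fun x : ℝ => 1 - x) (-1) s := (hasDerivAt_id s).const_sub 1
  refine (((h1.mul (h1.log hp)).add (h2.mul (h2.log hm))).const_mul (θ / 2)).congr_deriv ?_
  field_simp
  ring

theorem hasDerivAt_log_sub_log_s15 (θ : ℝ) {s : ℝ} (hs : s ∈ Set.Ioo (-1 : ℝ) 1) :
    HasDerivAt (fun x => θ / 2 * (Real.log (1 + x) - Real.log (1 - x)))
      (logPotentialDeriv θ 0 s) s := by
  have hp : 1 + s ≠ 0 := by linarith [hs.1]
  have hm : 1 - s ≠ 0 := by linarith [hs.2]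
  have h1 : HasDerivAt (fun x : ℝ => 1 + x) 1 s := (hasDerivAt_id s).const_add 1
  have h2 : HasDerivAt (fun x : ℝ => 1 - x) (-1) s := (hasDerivAt_id s).const_sub 1
  refine (((h1.log hp).sub (h2.log hm)).const_mul (θ / 2)).congr_deriv ?_
  simp only [logPotentialDeriv, Nat.factorial_zero, Nat.cast_one]
  ring

theorem hasDerivAt_logPotentialDeriv (θ : ℝ) (m : ℕ) {s : ℝ} (hs : s ∈ Set.Ioo (-1 : ℝ) 1) :
    HasDerivAt (logPotentialDeriv θ m) (logPotentialDeriv θ (m + 1) s) s := by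
  have hp : 1 + s ≠ 0 := by linarith [hs.1]
  have hm : 1 - s ≠ 0 := by linarith [hs.2]
  have h1 : HasDerivAt (fun x : ℝ => 1 + x) 1 s := (hasDerivAt_id s).const_add 1
  have h2 : HasDerivAt (fun x : ℝ => 1 - x) (-1) s := (hasDerivAt_id s).const_sub 1
  refine (((((h1.fun_inv hp).fun_pow (m + 1)).const_mul ((-1) ^ m)).add
    ((h2.fun_inv hm).fun_pow (m + 1))).const_mul (θ / 2 * m.factorial)).congr_deriv ?_
  simp only [logPotentialDeriv, Nat.factorial_succ, Nat.add_sub_cancel, div_eq_mul_inv,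
    ← inv_pow]
  push_cast
  ring

theorem iteratedDeriv_logPotential (θ : ℝ) (m : ℕ) :
    Set.EqOn (iteratedDeriv (m + 2) (logPotential θ)) (logPotentialDeriv θ m)
      (Set.Ioo (-1 : ℝ) 1) := by
  induction m with
  | zero =>
    have h1 : Set.EqOn (deriv (logPotential θ))
        (fun x => θ / 2 * (Real.log (1 + x) - Real.log (1 - x))) (Set.Ioo (-1 : ℝ) 1) :=
      fun s hs => (hasDerivAt_logPotential θ hs).deriv
    intro s hs
    rw [iteratedDeriv_succ, iteratedDeriv_one,
      (h1.eventuallyEq_of_mem (isOpen_Ioo.mem_nhds hs)).deriv_eq]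
    exact (hasDerivAt_log_sub_log_s15 θ hs).deriv
  | succ m ih =>
    intro s hs
    rw [show m + 1 + 2 = (m + 2) + 1 by ring, iteratedDeriv_succ,
      (ih.eventuallyEq_of_mem (isOpen_Ioo.mem_nhds hs)).deriv_eq]
    exact (hasDerivAt_logPotentialDeriv θ m hs).deriv

theorem logPotentialDeriv_odd (θ : ℝ) {m : ℕ} (hm : Even m) (s : ℝ) :
    logPotentialDeriv θ (m + 1) s =
      θ / 2 * (m + 1).factorial * (((1 - s)⁻¹) ^ (m + 2) - ((1 + s)⁻¹) ^ (m + 2)) := by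
  rw [logPotentialDeriv, hm.add_one.neg_one_pow]
  ring

theorem monotoneOn_logPotentialDeriv {θ : ℝ} (hθ : 0 ≤ θ) {m : ℕ} (hm : Even m) :
    MonotoneOn (logPotentialDeriv θ m) (Set.Ico (0 : ℝ) 1) := by
  have hd : ∀ s ∈ Set.Ico (0 : ℝ) 1,
      HasDerivAt (logPotentialDeriv θ m) (logPotentialDeriv θ (m + 1) s) s :=
    fun s hs => hasDerivAt_logPotentialDeriv θ m ⟨by linarith [hs.1], hs.2⟩
  refine monotoneOn_of_deriv_nonneg (convex_Ico 0 1)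
    (fun s hs => (hd s hs).continuousAt.continuousWithinAt)
    (fun s hs => (hd s (interior_subset hs)).differentiableAt.differentiableWithinAt)
    fun s hs => ?_
  obtain ⟨h0, h1⟩ := interior_subset hs
  rw [(hd s ⟨h0, h1⟩).deriv, logPotentialDeriv_odd θ hm]
  have hpos : 0 < 1 - s := by linarith
  have hle : ((1 + s)⁻¹) ^ (m + 2) ≤ ((1 - s)⁻¹) ^ (m + 2) := by gcongr; linarith
  exact mul_nonneg (by positivity) (sub_nonneg.2 hle)

theorem antitoneOn_logPotentialDeriv {θ : ℝ} (hθ : 0 ≤ θ) {m : ℕ} (hm : Even m) :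
    AntitoneOn (logPotentialDeriv θ m) (Set.Ioc (-1 : ℝ) 0) := by
  have heven : ∀ s, logPotentialDeriv θ m (-s) = logPotentialDeriv θ m s := by
    intro s
    simp only [logPotentialDeriv, hm.neg_one_pow, sub_neg_eq_add, ← sub_eq_add_neg]
    ring
  intro a ha b hb hab
  rw [← heven a, ← heven b]
  exact monotoneOn_logPotentialDeriv hθ hm ⟨by linarith [hb.2], by linarith [hb.1]⟩
    ⟨by linarith [ha.2], by linarith [ha.1]⟩ (neg_le_neg hab)

theorem stmt15
    (θ : ℝ) (hθ : 0 < θ) (F₁ : ℝ → ℝ)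
    (hF₁ : ∀ s : ℝ,
      F₁ s = θ / 2 * ((1 + s) * Real.log (1 + s) + (1 - s) * Real.log (1 - s))) :
    ∀ q : ℕ, 0 < q →
      MonotoneOn (iteratedDeriv (2 + 2 * q) F₁) (Set.Ico (0 : ℝ) 1) ∧
      AntitoneOn (iteratedDeriv (2 + 2 * q) F₁) (Set.Ioc (-1 : ℝ) 0) := by
  intro q _
  obtain rfl : F₁ = logPotential θ := funext hF₁
  have heq := iteratedDeriv_logPotential θ (2 * q)
  rw [add_comm 2]
  have hpos : Set.Ico (0 : ℝ) 1 ⊆ Set.Ioo (-1) 1 := fun s hs => ⟨by linarith [hs.1], hs.2⟩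
  have hneg : Set.Ioc (-1 : ℝ) 0 ⊆ Set.Ioo (-1) 1 := fun s hs => ⟨hs.1, by linarith [hs.2]⟩
  exact ⟨(monotoneOn_logPotentialDeriv hθ.le (even_two_mul q)).congr (heq.symm.mono hpos),
    (antitoneOn_logPotentialDeriv hθ.le (even_two_mul q)).congr (heq.symm.mono hneg)⟩
end
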